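/- arXiv:2209.05837 — 4 statements merged into one kernel-verified Lean document; each statement's English description precedes it below -/
import Mathlib

section
/- For every integer k ≥ 1 and every nonzero vector a ∈ ℝ^k, the ℝ^k-valued (Bochner) integral of the Gaussian first moment over the half-space determined by a satisfies ∫_{{y ∈ ℝ^k : ⟨a, y⟩ ≥ 0}} (4π)^{−k/2} · e^{−‖y‖²/4} · y \, dy = (1/√π) · a/‖a‖. -/
open scoped RealInnerProductSpace BigOperators

open MeasureTheory Set

/-- One-dimensional factor: normalised Gaussian, times `t` if `p`, cut to `t ≥ 0` if `q`. -/
noncomputable def gfac (p q : Bool) (t : ℝ) : ℝ :=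
  (if q then (if 0 ≤ t then 1 else 0) else 1) *
    ((Real.sqrt (4 * Real.pi))⁻¹ * ((if p then t else 1) * Real.exp (-(1 / 4) * t ^ 2)))

lemma gfac_integrable (p q : Bool) : Integrable (gfac p q) := by
  have h0 : Integrable (fun t : ℝ => (Real.sqrt (4 * Real.pi))⁻¹ *
      ((if p then t else 1) * Real.exp (-(1 / 4) * t ^ 2))) := by
    apply Integrable.const_mul
    cases p
    · simpa using integrable_exp_neg_mul_sq (b := 1 / 4) (by norm_num)
    · simpa using integrable_mul_exp_neg_mul_sq (b := 1 / 4) (by norm_num)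
  cases q
  · refine h0.congr ?_
    filter_upwards with t
    simp [gfac]
  · refine (h0.indicator (measurableSet_Ici (a := (0 : ℝ)))).congr ?_
    filter_upwards with t
    by_cases ht : 0 ≤ t <;> simp [gfac, ht]

lemma gfac_ff : ∫ t, gfac false false t = 1 := by
  simp only [gfac, Bool.false_eq_true, if_false, one_mul]
  rw [integral_const_mul, integral_gaussian]
  have : Real.pi / (1 / 4) = 4 * Real.pi := by ring
  rw [this]
  exact inv_mul_cancel₀ (by positivity)

lemma gfac_tf : ∫ t, gfac true false t = 0 := by
  have h : ∫ t, gfac true false (-t) = ∫ t, gfac true false t := integral_neg_eq_self _ _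
  have h2 : ∀ t, gfac true false (-t) = - gfac true false t := by
    intro t; simp [gfac]
  simp_rw [h2, integral_neg] at h
  linarith

lemma gfac_tt : ∫ t, gfac true true t = 1 / Real.sqrt Real.pi := by
  have h : gfac true true = (Ici (0 : ℝ)).indicator (fun t => (Real.sqrt (4 * Real.pi))⁻¹ *
      (t * Real.exp (-(1 / 4) * t ^ 2))) := by
    ext t
    by_cases ht : 0 ≤ t <;> simp [gfac, ht]
  rw [h, integral_indicator measurableSet_Ici, integral_Ici_eq_integral_Ioi, integral_const_mul]
  have := integral_rpow_mul_exp_neg_mul_rpow (p := 2) (q := 1) (b := 1 / 4)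
    (by norm_num) (by norm_num) (by norm_num)
  simp only [Real.rpow_one, Real.rpow_two] at this
  rw [this]
  have e : (-(1 + 1) / 2 : ℝ) = -1 := by norm_num
  rw [e, Real.rpow_neg_one, Real.sqrt_mul (by norm_num),
    show (4 : ℝ) = 2 ^ 2 by norm_num, Real.sqrt_sq (by norm_num)]
  norm_num
  field_simp

lemma const_eq (k : ℕ) : (4 * Real.pi) ^ (-(k : ℝ) / 2) = ((Real.sqrt (4 * Real.pi))⁻¹) ^ k := by
  have hp : (0 : ℝ) ≤ 4 * Real.pi := by positivity
  rw [Real.sqrt_eq_rpow, ← Real.rpow_neg hp, ← Real.rpow_natCast, ← Real.rpow_mul hp]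
  congr 1; ring

lemma prod_gfac {k : ℕ} (i0 j : Fin k) (x : Fin k → ℝ) :
    ∏ i, gfac (decide (i = j)) (decide (i = i0)) (x i) =
      (if 0 ≤ x i0 then 1 else 0) * (((4 * Real.pi) ^ (-(k : ℝ) / 2) *
        Real.exp (-(∑ i, x i ^ 2) / 4)) * x j) := by
  simp only [gfac, Finset.prod_mul_distrib, decide_eq_true_eq, Finset.prod_ite_eq',
    Finset.mem_univ, if_true, Finset.prod_const, Finset.card_univ, Fintype.card_fin, const_eq,
    ← Real.exp_sum, ← Finset.mul_sum]
  rw [show -(1 / 4) * ∑ i, x i ^ 2 = -(∑ i, x i ^ 2) / 4 by ring]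
  ring

/-- First moment of the Gaussian heat kernel at time 1 over a half-space through the
origin: `∫_{⟨a,y⟩ ≥ 0} (4π)^{-k/2} e^{-‖y‖²/4} y dy = (1/√π) a/‖a‖`. -/
theorem gaussian_halfspace_first_moment
    (k : ℕ) (hk : 1 ≤ k) (a : EuclideanSpace ℝ (Fin k)) (ha : a ≠ 0) :
    (∫ y in {y : EuclideanSpace ℝ (Fin k) | 0 ≤ ⟪a, y⟫},
        ((4 * Real.pi) ^ (-(k : ℝ) / 2) * Real.exp (-‖y‖ ^ 2 / 4)) • y)
      = (1 / Real.sqrt Real.pi) • (‖a‖⁻¹ • a) := by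
  have hna : 0 < ‖a‖ := norm_pos_iff.mpr ha
  let i0 : Fin k := ⟨0, hk⟩
  obtain ⟨b, hb⟩ : ∃ b : OrthonormalBasis (Fin k) ℝ (EuclideanSpace ℝ (Fin k)),
      b i0 = ‖a‖⁻¹ • a := by
    have hv : Orthonormal ℝ (({i0} : Set (Fin k)).domRestrict
        (fun _ : Fin k => ‖a‖⁻¹ • a)) := by
      constructor
      · intro i
        simp [norm_smul, hna.ne']
      · intro i j hij
        exact absurd (Subsingleton.elim i j) hij
    obtain ⟨b, hb⟩ := hv.exists_orthonormalBasis_extension_of_card_eq (by simp)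
    exact ⟨b, hb i0 rfl⟩
  have hmp : MeasurePreserving
      (b.measurableEquiv.trans (MeasurableEquiv.toLp 2 (Fin k → ℝ)).symm) volume volume :=
    (EuclideanSpace.volume_preserving_symm_measurableEquiv_toLp (Fin k)).comp
      b.measurePreserving_measurableEquiv
  have happ : ∀ y i, (b.measurableEquiv.trans (MeasurableEquiv.toLp 2 (Fin k → ℝ)).symm) y i
      = ⟪b i, y⟫ := fun y i => b.repr_apply_apply y i
  let F : Fin k → (Fin k → ℝ) → ℝ := fun j x =>
    ∏ i, gfac (decide (i = j)) (decide (i = i0)) (x i)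
  let e := b.measurableEquiv.trans (MeasurableEquiv.toLp 2 (Fin k → ℝ)).symm
  have hFi : ∀ j, Integrable (F j) := fun j =>
    Integrable.fintype_prod (f := fun i => gfac (decide (i = j)) (decide (i = i0)))
      (fun i => gfac_integrable _ _)
  have hFe : ∀ j, Integrable (fun y => F j (e y)) := fun j =>
    (hmp.integrable_comp_emb e.measurableEmbedding).mpr (hFi j)
  have hI : ∀ j, ∫ y, F j (e y) = if j = i0 then 1 / Real.sqrt Real.pi else 0 := by
    intro j
    rw [hmp.integral_comp' (F j)]
    simp only [F]
    rw [integral_fintype_prod_volume_eq_prod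
      (fun i => gfac (decide (i = j)) (decide (i = i0)))]
    split_ifs with hj
    · rw [hj, Finset.prod_eq_single i0]
      · simpa using gfac_tt
      · intro i _ hi
        simpa [hi] using gfac_ff
      · simp
    · apply Finset.prod_eq_zero (Finset.mem_univ j)
      simpa [hj] using gfac_tf
  have hms : MeasurableSet {y : EuclideanSpace ℝ (Fin k) | 0 ≤ ⟪a, y⟫} :=
    (isClosed_le continuous_const (continuous_const.inner continuous_id)).measurableSet
  rw [← integral_indicator hms]
  have hpt : ∀ y, ({y : EuclideanSpace ℝ (Fin k) | 0 ≤ ⟪a, y⟫}.indicator (fun y =>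
      ((4 * Real.pi) ^ (-(k : ℝ) / 2) * Real.exp (-‖y‖ ^ 2 / 4)) • y)) y
      = ∑ j, F j (e y) • b j := by
    intro y
    have hs : ∑ i, ⟪b i, y⟫ ^ 2 = ‖y‖ ^ 2 := by
      rw [← b.sum_sq_norm_inner_right y]; simp
    have hiff : 0 ≤ ⟪b i0, y⟫ ↔ 0 ≤ ⟪a, y⟫ := by
      rw [hb, real_inner_smul_left]
      exact mul_nonneg_iff_of_pos_left (inv_pos.mpr hna)
    simp only [F, prod_gfac, e, happ, hs, hiff]
    by_cases hy : 0 ≤ ⟪a, y⟫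
    · simp only [hy, if_true, one_mul, indicator, mem_ofPred_eq, mul_smul, ← Finset.smul_sum]
      rw [b.sum_repr' y]
    · simp [hy]
  simp_rw [hpt]
  rw [integral_finsetSum _ (fun j _ => (hFe j).smul_const (b j))]
  simp_rw [integral_smul_const, hI]
  simp [hb]
end

section
/- Let V be a finite set, let S : (V → ℝ) → (V → ℝ) be a linear map and let a > 0 be such that: (i) for all u, v : V → ℝ with |u| ≤ 1, |v| ≤ 1 pointwise and u ≤ v pointwise, one has S(u)(x) ≤ S(v)(x) + a for every x ∈ V; and (ii) |S(𝟙_V)(x) − 1| < a for every x ∈ V. For q ∈ ℝ and A ⊆ V define the thresholding map T^q(A) := { x ∈ V : S(𝟙_A)(x) ≥ q }. Then for every Ω ⊆ V and every B ⊆ V ∖ Ω one has the inclusions T^{1/2 + 2a}(B) ⊆ T^{1/2 + a}(V ∖ Ω) ⊆ V ∖ T^{1/2}(Ω). -/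
/-- One step of the abstract thresholding (MBO) scheme: if the linear diffusion
operator `S` satisfies an approximate maximum principle with error `a` and almost
preserves the constant `1`, then for `B ⊆ V ∖ Ω` one has
`T^{1/2+2a}(B) ⊆ T^{1/2+a}(V ∖ Ω) ⊆ V ∖ T^{1/2}(Ω)`. -/
theorem abstract_thresholding_one_step
    (V : Type*) [Fintype V]
    (S : (V → ℝ) →ₗ[ℝ] (V → ℝ)) (a : ℝ) (ha : 0 < a)
    (hmax : ∀ u v : V → ℝ, (∀ x, |u x| ≤ 1) → (∀ x, |v x| ≤ 1) →
      (∀ x, u x ≤ v x) → ∀ x, S u x ≤ S v x + a)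
    (hmass : ∀ x, |S (fun _ => (1 : ℝ)) x - 1| < a)
    (T : ℝ → Set V → Set V)
    (hT : ∀ q A, T q A = {x | q ≤ S (A.indicator fun _ => (1 : ℝ)) x})
    (Ω B : Set V) (hB : B ⊆ Ωᶜ) :
    T (1 / 2 + 2 * a) B ⊆ T (1 / 2 + a) Ωᶜ ∧
    T (1 / 2 + a) Ωᶜ ⊆ (T (1 / 2) Ω)ᶜ := by
  have hind : ∀ (A : Set V) (x : V), |A.indicator (fun _ => (1 : ℝ)) x| ≤ 1 := by
    intro A x
    by_cases h : x ∈ A <;> simp [h]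
  constructor
  · intro x hx
    rw [hT, Set.mem_setOf_eq] at hx ⊢
    have h := hmax _ _ (hind B) (hind Ωᶜ)
      (fun y => Set.indicator_le_indicator_of_subset hB (fun _ => zero_le_one) y) x
    linarith
  · intro x hx hx2
    rw [hT, Set.mem_setOf_eq] at hx hx2
    have hsum : S (Ω.indicator fun _ => (1 : ℝ)) x + S (Ωᶜ.indicator fun _ => (1 : ℝ)) x
        = S (fun _ => (1 : ℝ)) x := by
      rw [← Pi.add_apply, ← map_add, Set.indicator_self_add_compl]
    have h := (abs_lt.mp (hmass x)).2
    linarith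
end

section
/- Let V be a finite set, let S : (V → ℝ) → (V → ℝ) be a linear map and let a > 0 be such that: (i) for all u, v : V → ℝ with |u| ≤ 1, |v| ≤ 1 pointwise and u ≤ v pointwise, one has S(u)(x) ≤ S(v)(x) + a for every x ∈ V; and (ii) |S(𝟙_V)(x) − 1| < a for every x ∈ V. For q ∈ ℝ and A ⊆ V define T^q(A) := { x ∈ V : S(𝟙_A)(x) ≥ q }, and let (T^q)^m denote the m-fold iterate. Then for every integer m ≥ 1, every Ω ⊆ V and every B ⊆ V ∖ Ω, one has (T^{1/2 + 2ma})^m(B) ⊆ V ∖ (T^{1/2})^m(Ω). -/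
/-- Iterated abstract thresholding (MBO) scheme: under the approximate maximum
principle with error `a` and approximate mass conservation, for every `m ≥ 1` and
`B ⊆ V ∖ Ω` one has `(T^{1/2+2ma})^m(B) ⊆ V ∖ (T^{1/2})^m(Ω)`. -/
theorem abstract_thresholding_iterated
    (V : Type*) [Fintype V]
    (S : (V → ℝ) →ₗ[ℝ] (V → ℝ)) (a : ℝ) (ha : 0 < a)
    (hmax : ∀ u v : V → ℝ, (∀ x, |u x| ≤ 1) → (∀ x, |v x| ≤ 1) →
      (∀ x, u x ≤ v x) → ∀ x, S u x ≤ S v x + a)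
    (hmass : ∀ x, |S (fun _ => (1 : ℝ)) x - 1| < a)
    (T : ℝ → Set V → Set V)
    (hT : ∀ q A, T q A = {x | q ≤ S (A.indicator fun _ => (1 : ℝ)) x}) :
    ∀ m : ℕ, 1 ≤ m → ∀ Ω B : Set V, B ⊆ Ωᶜ →
      (T (1 / 2 + 2 * (m : ℝ) * a))^[m] B ⊆ ((T (1 / 2))^[m] Ω)ᶜ := by
  have step : ∀ q : ℝ, 1 / 2 + 2 * a ≤ q → ∀ Ω B : Set V, B ⊆ Ωᶜ →
      T q B ⊆ (T (1 / 2) Ω)ᶜ := by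
    intro q hq Ω B hB x hx hx'
    rw [hT] at hx hx'
    simp only [Set.mem_setOf_eq] at hx hx'
    have hb : ∀ (A : Set V) (y : V), |A.indicator (fun _ => (1 : ℝ)) y| ≤ 1 := by
      intro A y
      by_cases h : y ∈ A <;> simp [h]
    have h1 := hmax _ _ (hb B) (hb Ωᶜ)
      (fun y => Set.indicator_le_indicator_of_subset hB (fun _ => zero_le_one) y) x
    have h2 : S (Ωᶜ.indicator fun _ => (1 : ℝ)) x + S (Ω.indicator fun _ => (1 : ℝ)) x
        = S (fun _ => (1 : ℝ)) x := by
      rw [← Pi.add_apply, ← map_add, Set.indicator_compl_add_self]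
    have h3 := (abs_lt.mp (hmass x)).2
    linarith
  intro m hm Ω B hB
  have hq : 1 / 2 + 2 * a ≤ 1 / 2 + 2 * (m : ℝ) * a := by
    have : (1 : ℝ) ≤ m := by exact_mod_cast hm
    nlinarith
  generalize 1 / 2 + 2 * (m : ℝ) * a = q at hq
  clear hm
  induction m with
  | zero => simpa using hB
  | succ k ih =>
    rw [Function.iterate_succ_apply', Function.iterate_succ_apply']
    exact step q hq _ _ ih
end

section
/- Let k ≥ 2 be an integer and let A ≥ 0 and B ≥ 0. Then there exist constants γ > 0, C > 0 and h₀ ∈ (0, 1], depending only on k, A and B, with the following property. Let 0 < h ≤ h₀, let ζ : ℝ^{k−1} → ℝ be a measurable function with |ζ(y)| ≤ A·‖y‖² for all y ∈ ℝ^{k−1}, let ω ∈ ℝ with |ω| ≤ B, and let z ∈ [0, γ·√h] satisfy the one-step thresholding equation ω·√h = ∫_{ℝ^{k−1}} ∫_0^{ζ(y)+z} (4πh)^{−k/2} · e^{−(‖y‖² + s²)/(4h)} \, ds \, dy, where the inner integral is understood as a signed (oriented) integral when ζ(y) + z < 0. Then z ≤ C·h. -/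
open MeasureTheory in
lemma gauss_integrable_aux {n : ℕ} {b : ℝ} (hb : 0 < b) :
    Integrable (fun y : EuclideanSpace ℝ (Fin n) => Real.exp (-b * ‖y‖ ^ 2)) := by
  by_contra hcon
  have h1 := GaussianFourier.integral_rexp_neg_mul_sq_norm
    (V := EuclideanSpace ℝ (Fin n)) hb
  rw [integral_undef hcon] at h1
  have : 0 < (Real.pi / b) ^ ((Module.finrank ℝ (EuclideanSpace ℝ (Fin n)) : ℝ) / 2) := by
    have := Real.pi_pos
    positivity
  linarith

lemma G_lip_aux (h : ℝ) (hh : 0 < h) (a b : ℝ) :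
    |∫ s in a..b, Real.exp (-s ^ 2 / (4 * h))| ≤ |b - a| := by
  have := intervalIntegral.norm_integral_le_of_norm_le_const (a := a) (b := b) (C := 1)
    (f := fun s : ℝ => Real.exp (-s ^ 2 / (4 * h))) (by
      intro x _
      rw [Real.norm_eq_abs, abs_of_pos (Real.exp_pos _), Real.exp_le_one_iff]
      have : 0 ≤ x ^ 2 / (4 * h) := by positivity
      rw [neg_div]; linarith)
  simpa using this

lemma G_lower_aux (h z : ℝ) (hh : 0 < h) (hz : 0 ≤ z) (hz2 : z ≤ Real.sqrt h) :
    3 / 4 * z ≤ ∫ s in (0 : ℝ)..z, Real.exp (-s ^ 2 / (4 * h)) := by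
  have h1 : ∫ s in (0 : ℝ)..z, (3 / 4 : ℝ) ≤ ∫ s in (0 : ℝ)..z, Real.exp (-s ^ 2 / (4 * h)) := by
    apply intervalIntegral.integral_mono_on hz (by simp)
    · apply Continuous.intervalIntegrable; fun_prop
    · intro s hs
      have h2 : s ^ 2 ≤ h := by
        rw [← Real.sq_sqrt hh.le]
        exact pow_le_pow_left₀ hs.1 (hs.2.trans hz2) 2
      have h3 : s ^ 2 / (4 * h) ≤ 1 / 4 := by
        rw [div_le_iff₀ (by positivity)]; linarith
      have := Real.add_one_le_exp (-s ^ 2 / (4 * h))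
      rw [neg_div] at this ⊢
      linarith
  simp at h1
  linarith

/-- One-step MBO displacement bound in local graph coordinates: if the boundary of the
set is the graph of `ζ` with `|ζ(y)| ≤ A‖y‖²`, the drift `ω` is bounded by `B`, and the
displacement `z ∈ [0, γ√h]` satisfies the one-step thresholding equation, then `z ≤ Ch`,
with constants depending only on `k`, `A`, `B`. -/
theorem mbo_one_step_displacement_bound
    (k : ℕ) (hk : 2 ≤ k) (A B : ℝ) (hA : 0 ≤ A) (hB : 0 ≤ B) :
    ∃ γ C h₀ : ℝ, 0 < γ ∧ 0 < C ∧ 0 < h₀ ∧ h₀ ≤ 1 ∧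
      ∀ h : ℝ, 0 < h → h ≤ h₀ →
      ∀ ζ : EuclideanSpace ℝ (Fin (k - 1)) → ℝ, Measurable ζ →
        (∀ y, |ζ y| ≤ A * ‖y‖ ^ 2) →
      ∀ ω : ℝ, |ω| ≤ B →
      ∀ z : ℝ, 0 ≤ z → z ≤ γ * Real.sqrt h →
        (ω * Real.sqrt h
            = ∫ y : EuclideanSpace ℝ (Fin (k - 1)),
                ∫ s in (0 : ℝ)..(ζ y + z),
                  (4 * Real.pi * h) ^ (-(k : ℝ) / 2)
                    * Real.exp (-(‖y‖ ^ 2 + s ^ 2) / (4 * h))) →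
        z ≤ C * h := by
  have hpi := Real.pi_pos
  refine ⟨1, 4 / 3 * (B * Real.sqrt (4 * Real.pi) + A * 8 * 2 ^ (((k - 1 : ℕ) : ℝ) / 2)) + 1, 1,
    one_pos, by positivity, one_pos, le_rfl, ?_⟩
  generalize hn : k - 1 = n
  intro h hh _ ζ hζm hζ ω hω z hz hzγ heq
  rw [one_mul] at hzγ
  set c : ℝ := (4 * Real.pi * h) ^ (-(k : ℝ) / 2) with hc
  have hcpos : 0 < c := by positivity
  set G : ℝ → ℝ := fun t => ∫ s in (0 : ℝ)..t, Real.exp (-s ^ 2 / (4 * h)) with hG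
  set b₁ : ℝ := 1 / (4 * h) with hb₁
  set b₂ : ℝ := 1 / (8 * h) with hb₂
  have hb₁p : 0 < b₁ := by positivity
  have hb₂p : 0 < b₂ := by positivity
  have hcont : Continuous (fun s : ℝ => Real.exp (-s ^ 2 / (4 * h))) := by fun_prop
  have hGc : Continuous G :=
    intervalIntegral.continuous_primitive (fun a b => hcont.intervalIntegrable a b) 0
  have hGl : ∀ t, 3 / 4 * z - |t| ≤ G (t + z) := by
    intro t
    have h1 : G z + (∫ s in z..(t + z), Real.exp (-s ^ 2 / (4 * h))) = G (t + z) :=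
      intervalIntegral.integral_add_adjacent_intervals
        (hcont.intervalIntegrable _ _) (hcont.intervalIntegrable _ _)
    have h2 := G_lip_aux h hh z (t + z)
    have h3 := G_lower_aux h z hh hz hzγ
    rw [add_sub_cancel_right] at h2
    have h4 := (abs_le.1 h2).1
    change 3 / 4 * z ≤ G z at h3
    linarith
  have hGu : ∀ t, |G (t + z)| ≤ |t| + z := by
    intro t
    have h2 := G_lip_aux h hh 0 (t + z)
    rw [sub_zero] at h2
    have h3 := abs_add_le t z
    rw [abs_of_nonneg hz] at h3
    exact h2.trans h3
  have hinner : ∀ y : EuclideanSpace ℝ (Fin n),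
      (∫ s in (0 : ℝ)..(ζ y + z), c * Real.exp (-(‖y‖ ^ 2 + s ^ 2) / (4 * h)))
        = c * (Real.exp (-b₁ * ‖y‖ ^ 2) * G (ζ y + z)) := by
    intro y
    rw [hG, ← intervalIntegral.integral_const_mul, ← intervalIntegral.integral_const_mul]
    congr 1
    ext s
    rw [← Real.exp_add]
    congr 2
    rw [hb₁]; field_simp; ring
  replace heq := heq.trans
    (MeasureTheory.integral_congr_ae (Filter.Eventually.of_forall hinner))
  rw [MeasureTheory.integral_const_mul] at heq
  have hsq : ∀ y : EuclideanSpace ℝ (Fin n),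
      Real.exp (-b₁ * ‖y‖ ^ 2) * |ζ y| ≤ A * (8 * h) * Real.exp (-b₂ * ‖y‖ ^ 2) := by
    intro y
    have h1 : -b₁ * ‖y‖ ^ 2 = -b₂ * ‖y‖ ^ 2 + -(b₂ * ‖y‖ ^ 2) := by
      rw [hb₁, hb₂]; field_simp; ring
    have h2 : ‖y‖ ^ 2 = 8 * h * (b₂ * ‖y‖ ^ 2) := by
      rw [hb₂]; field_simp
    set x := b₂ * ‖y‖ ^ 2 with hx
    have h3 : Real.exp (-x) * x ≤ 1 := by
      rw [Real.exp_neg, inv_mul_le_iff₀ (Real.exp_pos _)]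
      linarith [Real.add_one_le_exp x]
    calc Real.exp (-b₁ * ‖y‖ ^ 2) * |ζ y| ≤ Real.exp (-b₁ * ‖y‖ ^ 2) * (A * ‖y‖ ^ 2) := by
          gcongr; exact hζ y
      _ = A * (8 * h) * Real.exp (-b₂ * ‖y‖ ^ 2) * (Real.exp (-x) * x) := by
          rw [h1, Real.exp_add]
          have : A * ‖y‖ ^ 2 = A * (8 * h * x) := by rw [← h2]
          rw [this]; ring
      _ ≤ A * (8 * h) * Real.exp (-b₂ * ‖y‖ ^ 2) * 1 := by gcongr
      _ = _ := by ring
  have hi₁ := gauss_integrable_aux (n := n) hb₁p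
  have hi₂ := gauss_integrable_aux (n := n) hb₂p
  have hFint : MeasureTheory.Integrable (fun y : EuclideanSpace ℝ (Fin n) =>
      Real.exp (-b₁ * ‖y‖ ^ 2) * G (ζ y + z)) := by
    refine ((hi₁.mul_const z).add (hi₂.const_mul (A * (8 * h)))).mono' ?_ ?_
    · apply Measurable.aestronglyMeasurable
      exact (by fun_prop : Measurable fun y : EuclideanSpace ℝ (Fin n) =>
        Real.exp (-b₁ * ‖y‖ ^ 2)).mul (hGc.measurable.comp (hζm.add_const z))
    · refine Filter.Eventually.of_forall fun y => ?_
      rw [Real.norm_eq_abs, abs_mul, abs_of_pos (Real.exp_pos _)]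
      have h1 := mul_le_mul_of_nonneg_left (hGu (ζ y)) (Real.exp_pos (-b₁ * ‖y‖ ^ 2)).le
      have h2 := hsq y
      simp only [Pi.add_apply]
      linarith
  have hlow := MeasureTheory.integral_mono
    ((hi₁.mul_const (3 / 4 * z)).sub (hi₂.const_mul (A * (8 * h)))) hFint (by
      intro y
      have h1 := mul_le_mul_of_nonneg_left (hGl (ζ y)) (Real.exp_pos (-b₁ * ‖y‖ ^ 2)).le
      have h2 := hsq y
      simp only [Pi.sub_apply]
      linarith)
  rw [MeasureTheory.integral_sub' (hi₁.mul_const (3 / 4 * z)) (hi₂.const_mul (A * (8 * h))),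
    MeasureTheory.integral_mul_const, MeasureTheory.integral_const_mul,
    GaussianFourier.integral_rexp_neg_mul_sq_norm hb₁p,
    GaussianFourier.integral_rexp_neg_mul_sq_norm hb₂p, finrank_euclideanSpace_fin] at hlow
  have e1 : Real.pi / b₁ = 4 * Real.pi * h := by rw [hb₁]; field_simp
  have e2 : Real.pi / b₂ = 2 * (4 * Real.pi * h) := by rw [hb₂]; field_simp; ring
  rw [e1, e2, Real.mul_rpow (x := 2) (y := 4 * Real.pi * h) (by norm_num) (by positivity)] at hlow
  set P : ℝ := (4 * Real.pi * h) ^ ((n : ℝ) / 2) with hP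
  set T : ℝ := (2 : ℝ) ^ ((n : ℝ) / 2) with hT
  have hcP : c * P * Real.sqrt (4 * Real.pi * h) = 1 := by
    rw [Real.sqrt_eq_rpow, hc, hP, ← Real.rpow_add (by positivity),
      ← Real.rpow_add (by positivity)]
    have : (n : ℝ) = k - 1 := by rw [← hn, Nat.cast_sub (by omega)]; simp
    rw [this]
    convert Real.rpow_zero _ using 2
    ring
  set S := Real.sqrt (4 * Real.pi * h) with hS
  have hS' : S = Real.sqrt (4 * Real.pi) * Real.sqrt h := Real.sqrt_mul (by positivity) h
  have hS0 : 0 ≤ S := Real.sqrt_nonneg _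
  have hfin := mul_le_mul_of_nonneg_left hlow (mul_nonneg hcpos.le hS0)
  have hl : c * S * (P * (3 / 4 * z) - A * (8 * h) * (T * P)) = 3 / 4 * z - A * (8 * h) * T := by
    linear_combination (3 / 4 * z - A * (8 * h) * T) * hcP
  rw [hl] at hfin
  have hss := Real.mul_self_sqrt hh.le
  have hr : c * S * (∫ y : EuclideanSpace ℝ (Fin n), Real.exp (-b₁ * ‖y‖ ^ 2) * G (ζ y + z))
      = ω * (Real.sqrt (4 * Real.pi) * h) := by
    calc _ = S * (ω * Real.sqrt h) := by rw [heq]; ring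
      _ = ω * (Real.sqrt (4 * Real.pi) * (Real.sqrt h * Real.sqrt h)) := by rw [hS']; ring
      _ = _ := by rw [hss]
  rw [hr] at hfin
  have hω' : ω * (Real.sqrt (4 * Real.pi) * h) ≤ B * (Real.sqrt (4 * Real.pi) * h) :=
    mul_le_mul_of_nonneg_right ((le_abs_self ω).trans hω) (by positivity)
  nlinarith
end
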